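/- Let A be a probability group and set u_A := (1/n(A)) Σ_{a∈A} h_a·a ∈ ℂ[A]. Then u_A is an idempotent element (u_A·u_A = u_A) and a·u_A = u_A = u_A·a for every a ∈ A. -/

import Mathlib

open Finset

/-- A probability group: a finite set `A` with `p : A × A × A → ℝ`
(written `p a b c` for `p(a.b = c)`), an identity element `one` and an
involution `star` satisfying the axioms of Harrison. -/
structure ProbabilityGroup (A : Type*) [Fintype A] where
  /-- the structure function `p(a.b = c)` -/
  p : A → A → A → ℝ
  /-- the identity element `1` -/
  one : A
  /-- the involution `a ↦ a*` -/
  star : A → A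
  nonneg : ∀ a b c, 0 ≤ p a b c
  sum_eq_one : ∀ a b, ∑ c, p a b c = 1
  assoc : ∀ a b c d, ∑ x, p a b x * p x c d = ∑ y, p a y d * p b c y
  one_mul : ∀ a, p one a a = 1
  mul_one : ∀ a, p a one a = 1
  star_pos : ∀ b, 0 < p b (star b) one
  star_unique : ∀ b b', 0 < p b b' one → b' = star b
  p_star : ∀ a b c, p a b c = p (star b) (star a) (star c)
  star_symm : ∀ a, p a (star a) one = p (star a) a one

variable {A : Type*} [Fintype A] [DecidableEq A]

/-- The multiplication of `ℂ[A]` (realized as `A → ℂ` via coordinates in the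
basis `A`): on basis elements, `a·b = ∑ c, p(a.b = c) • c`. -/
noncomputable def Pmul (G : ProbabilityGroup A) (f g : A → ℂ) : A → ℂ :=
  fun c => ∑ a : A, ∑ b : A, f a * g b * (G.p a b c : ℂ)

/-- The basis element of `ℂ[A]` corresponding to `a ∈ A`. -/
def delta (a : A) : A → ℂ := fun c => if c = a then 1 else 0

/-- The weight `h_a := 1 / p(a.a* = 1)`. -/
noncomputable def wt (G : ProbabilityGroup A) (a : A) : ℝ :=
  1 / G.p a (G.star a) G.one

/-- The total weight `n(A) := ∑ a, h_a`. -/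
noncomputable def nPG (G : ProbabilityGroup A) : ℝ := ∑ a : A, wt G a

/-- The normalized idempotent `u_A := (1/n(A)) ∑ a, h_a • a`. -/
noncomputable def uA (G : ProbabilityGroup A) : A → ℂ :=
  fun a => ((wt G a / nPG G : ℝ) : ℂ)

namespace ProbabilityGroup

omit [DecidableEq A]

theorem star_star (G : ProbabilityGroup A) (a : A) : G.star (G.star a) = a :=
  (G.star_unique _ _ (G.star_symm a ▸ G.star_pos a)).symm

theorem p_eq_zero (G : ProbabilityGroup A) {a b : A} (h : b ≠ G.star a) : G.p a b G.one = 0 :=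
  le_antisymm (not_lt.mp fun hp => h (G.star_unique a b hp)) (G.nonneg a b G.one)

theorem sum_p_star (G : ProbabilityGroup A) (a b : A) : ∑ c, G.p a b (G.star c) = 1 :=
  (Equiv.sum_comp (Function.Involutive.toPerm G.star G.star_star) (G.p a b)).trans
    (G.sum_eq_one a b)

theorem wt_pos (G : ProbabilityGroup A) (a : A) : 0 < wt G a :=
  one_div_pos.mpr (G.star_pos a)

theorem wt_star (G : ProbabilityGroup A) (a : A) : wt G (G.star a) = wt G a := by
  rw [wt, wt, star_star, G.star_symm]

theorem nPG_pos (G : ProbabilityGroup A) : 0 < nPG G :=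
  Finset.sum_pos (fun a _ => G.wt_pos a) ⟨G.one, Finset.mem_univ _⟩

theorem wt_mul_p_star (G : ProbabilityGroup A) (a b c : A) :
    wt G a * G.p a b (G.star c) = wt G c * G.p b c (G.star a) := by
  have h := G.assoc a b c G.one
  rw [Finset.sum_eq_single (G.star c), Finset.sum_eq_single (G.star a), ← G.star_symm c] at h
  · have ha := (G.star_pos a).ne'
    have hc := (G.star_pos c).ne'
    rw [wt, wt]
    field_simp
    linarith
  · intro y _ hy
    rw [G.p_eq_zero hy, zero_mul]
  · simp
  · intro x _ hx
    rw [G.p_eq_zero (a := x) (b := c), mul_zero]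
    rintro rfl
    exact hx (G.star_star x).symm
  · simp

theorem sum_wt_mul_p_left (G : ProbabilityGroup A) (b c : A) :
    ∑ a, wt G a * G.p a b c = wt G c := by
  rw [← G.star_star c]
  simp_rw [G.wt_mul_p_star, ← Finset.mul_sum, G.sum_p_star, _root_.mul_one, G.wt_star]

theorem sum_wt_mul_p_right (G : ProbabilityGroup A) (a c : A) :
    ∑ b, wt G b * G.p a b c = wt G c := by
  rw [← G.star_star c]
  have h (b : A) : wt G b * G.p a b (G.star (G.star c)) =
      wt G (G.star c) * G.p (G.star c) a (G.star b) :=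
    mul_left_cancel₀ (G.wt_pos a).ne' <| by
      linear_combination wt G b * G.wt_mul_p_star a b (G.star c) +
        wt G (G.star c) * G.wt_mul_p_star b (G.star c) a
  simp_rw [h, ← Finset.mul_sum, G.sum_p_star, _root_.mul_one, G.wt_star]

theorem sum_uA_mul_p_left (G : ProbabilityGroup A) (b c : A) :
    ∑ a, uA G a * (G.p a b c : ℂ) = uA G c := by
  simp only [uA]
  rw [← G.sum_wt_mul_p_left b c, Finset.sum_div]
  push_cast
  exact Finset.sum_congr rfl fun a _ => by ring

theorem sum_uA_mul_p_right (G : ProbabilityGroup A) (a c : A) :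
    ∑ b, uA G b * (G.p a b c : ℂ) = uA G c := by
  simp only [uA]
  rw [← G.sum_wt_mul_p_right a c, Finset.sum_div]
  push_cast
  exact Finset.sum_congr rfl fun b _ => by ring

theorem sum_uA (G : ProbabilityGroup A) : ∑ a, uA G a = 1 := by
  simp only [uA]
  rw [← Complex.ofReal_sum, ← Finset.sum_div, ← nPG, div_self G.nPG_pos.ne', Complex.ofReal_one]

theorem Pmul_uA (G : ProbabilityGroup A) (f : A → ℂ) : Pmul G f (uA G) = (∑ a, f a) • uA G := by
  funext c
  simp_rw [Pmul, mul_assoc, ← Finset.mul_sum, G.sum_uA_mul_p_right, Pi.smul_apply, smul_eq_mul,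
    Finset.sum_mul]

theorem uA_Pmul (G : ProbabilityGroup A) (f : A → ℂ) : Pmul G (uA G) f = (∑ a, f a) • uA G := by
  funext c
  rw [Pmul, Finset.sum_comm, Pi.smul_apply, smul_eq_mul, Finset.sum_mul]
  refine Finset.sum_congr rfl fun b _ => ?_
  rw [← G.sum_uA_mul_p_left b c, Finset.mul_sum]
  exact Finset.sum_congr rfl fun a _ => by ring

end ProbabilityGroup

theorem sum_delta (a : A) : ∑ b, delta a b = 1 := by
  simp [delta]

/-- In a probability group `A`, the element
`u_A = (1/n(A)) ∑ a, h_a • a` of `ℂ[A]` is idempotent and satisfies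
`a·u_A = u_A = u_A·a` for all basis elements `a ∈ A`. -/
theorem stmt_2 {A : Type*} [Fintype A] [DecidableEq A] (G : ProbabilityGroup A) :
    Pmul G (uA G) (uA G) = uA G ∧
    (∀ a : A, Pmul G (delta a) (uA G) = uA G ∧ Pmul G (uA G) (delta a) = uA G) := by
  refine ⟨?_, fun a => ⟨?_, ?_⟩⟩
  · rw [G.Pmul_uA, G.sum_uA, one_smul]
  · rw [G.Pmul_uA, sum_delta, one_smul]
  · rw [G.uA_Pmul, sum_delta, one_smul]
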